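/- Let 1 ≤ k ∈ ℕ, let G be a finite graph, and let S be a set of proper separations of G of order < k that contains all tight separations of order < k and is invariant under the automorphisms of G. Then G has a canonical tree-decomposition (T,𝒱), all of whose separations induced by tree edges lie in S, such that (i) any two distinct k-blocks of G are contained in different parts (no part V_t contains two distinct k-blocks, and every k-block is contained in some part), and (ii) every part V_t that contains a k-block X that is well separated in S satisfies V_t = X. -/

import Mathlib

open SimpleGraph Set

namespace CanonicalTD

variable {V : Type*} {ι : Type*}

/-- `p = (A,B)` is a separation of `G`: `A ∪ B = V` and no edge between `A∖B` and `B∖A`. -/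
def IsSep (G : SimpleGraph V) (p : Set V × Set V) : Prop :=
  p.1 ∪ p.2 = univ ∧ ∀ a ∈ p.1 \ p.2, ∀ b ∈ p.2 \ p.1, ¬G.Adj a b

/-- The order `|A ∩ B|` of a separation `(A,B)`. -/
noncomputable def sepOrder (p : Set V × Set V) : ℕ := (p.1 ∩ p.2).ncard

/-- A separation is proper if both `A∖B` and `B∖A` are nonempty. -/
def ProperSep (p : Set V × Set V) : Prop := (p.1 \ p.2).Nonempty ∧ (p.2 \ p.1).Nonempty

/-- The partial order on separations: `(A,B) ≤ (C,D)` iff `A ⊆ C` and `D ⊆ B`. -/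
def SepLE (p q : Set V × Set V) : Prop := p.1 ⊆ q.1 ∧ q.2 ⊆ p.2

/-- Two separations are nested if they become comparable after possibly inverting. -/
def Nested (p q : Set V × Set V) : Prop :=
  SepLE p q ∨ SepLE q p ∨ SepLE p q.swap ∨ SepLE q.swap p

/-- A separation `(A,B)` is tight if every vertex of `A ∩ B` has a neighbour in `A∖B`
and a neighbour in `B∖A`. -/
def TightSep (G : SimpleGraph V) (p : Set V × Set V) : Prop :=
  ∀ v ∈ p.1 ∩ p.2, (∃ a ∈ p.1 \ p.2, G.Adj v a) ∧ ∃ b ∈ p.2 \ p.1, G.Adj v b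

/-- `S_k`: the set of all proper separations of `G` of order `< k`. -/
def Sk (G : SimpleGraph V) (k : ℕ) : Set (Set V × Set V) :=
  {p | IsSep G p ∧ ProperSep p ∧ sepOrder p < k}

/-- A separation system of `G`: a set of separations closed under inverses. -/
def IsSepSystem (G : SimpleGraph V) (N : Set (Set V × Set V)) : Prop :=
  (∀ p ∈ N, IsSep G p) ∧ ∀ p ∈ N, p.swap ∈ N

def NestedSystem (N : Set (Set V × Set V)) : Prop :=
  ∀ p ∈ N, ∀ q ∈ N, Nested p q

def ProperSystem (N : Set (Set V × Set V)) : Prop := ∀ p ∈ N, ProperSep p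

/-- An orientation of `N`: contains exactly one of `(A,B)`, `(B,A)` for each `(A,B) ∈ N`. -/
def IsOrientation (N O : Set (Set V × Set V)) : Prop :=
  O ⊆ N ∧ ∀ p ∈ N, (p ∈ O ↔ p.swap ∉ O)

/-- Consistency: no distinct `(A,B),(C,D) ∈ O` with `(D,C) ≤ (A,B)`. -/
def Consistent (O : Set (Set V × Set V)) : Prop :=
  ∀ p ∈ O, ∀ q ∈ O, p ≠ q → ¬SepLE q.swap p

/-- A `k`-profile of `G`. -/
def IsProfile (G : SimpleGraph V) (k : ℕ) (P : Set (Set V × Set V)) : Prop :=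
  IsOrientation (Sk G k) P ∧ Consistent P ∧
    ∀ p ∈ P, ∀ q ∈ P, (p.2 ∩ q.2, p.1 ∪ q.1) ∉ P

/-- `(T, Vt)` is a tree-decomposition of `G`. -/
def IsTreeDecomp (G : SimpleGraph V) (T : SimpleGraph ι) (Vt : ι → Set V) : Prop :=
  T.IsTree ∧ (⋃ t, Vt t) = univ ∧
  (∀ u v, G.Adj u v → ∃ t, u ∈ Vt t ∧ v ∈ Vt t) ∧
  ∀ (t1 t3 : ι) (w : T.Walk t1 t3), w.IsPath →
    ∀ t2 ∈ w.support, Vt t1 ∩ Vt t3 ⊆ Vt t2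

/-- The vertex set of the component of `T - t1t2` containing `t1`. -/
def side (T : SimpleGraph ι) (t1 t2 : ι) : Set ι :=
  {s | (T.deleteEdges {s(t1, t2)}).Reachable t1 s}

/-- The separation induced by the oriented edge `(t1, t2)` of `T`. -/
def inducedSep (T : SimpleGraph ι) (Vt : ι → Set V) (t1 t2 : ι) : Set V × Set V :=
  (⋃ s ∈ side T t1 t2, Vt s, ⋃ s ∈ side T t2 t1, Vt s)

/-- The set of separations induced by oriented edges of `T`. -/
def inducedSeps (T : SimpleGraph ι) (Vt : ι → Set V) : Set (Set V × Set V) :=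
  {p | ∃ t1 t2, T.Adj t1 t2 ∧ p = inducedSep T Vt t1 t2}

/-- `O(t)`: separations induced by oriented edges `(t1,t2)` with `t` in the component of `t2`. -/
def Otow (T : SimpleGraph ι) (Vt : ι → Set V) (t : ι) : Set (Set V × Set V) :=
  {p | ∃ t1 t2, T.Adj t1 t2 ∧ t ∈ side T t2 t1 ∧ p = inducedSep T Vt t1 t2}

/-- The map assigning to each oriented edge of `T` its induced separation is a bijection
onto `N`. -/
def EdgeSepBij (T : SimpleGraph ι) (Vt : ι → Set V) (N : Set (Set V × Set V)) : Prop :=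
  (∀ t1 t2, T.Adj t1 t2 → inducedSep T Vt t1 t2 ∈ N) ∧
  ∀ p ∈ N, ∃! e : ι × ι, T.Adj e.1 e.2 ∧ inducedSep T Vt e.1 e.2 = p

/-- The tree-decomposition has adhesion `< k`. -/
def AdhesionLt (T : SimpleGraph ι) (Vt : ι → Set V) (k : ℕ) : Prop :=
  ∀ t1 t2, T.Adj t1 t2 → (Vt t1 ∩ Vt t2).ncard < k

/-- The tree-decomposition is canonical: the automorphism group of `G` acts on `T`
compatibly with the parts. -/
def Canonical (G : SimpleGraph V) (T : SimpleGraph ι) (Vt : ι → Set V) : Prop :=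
  ∃ ρ : (G ≃g G) → (T ≃g T),
    (∀ φ ψ : G ≃g G, ρ (φ.trans ψ) = (ρ φ).trans (ρ ψ)) ∧
    ∀ (φ : G ≃g G) (t : ι), (⇑φ) '' Vt t = Vt (ρ φ t)

/-- `X` is `(<k)`-inseparable in `G`. -/
def Inseparable' (G : SimpleGraph V) (k : ℕ) (X : Set V) : Prop :=
  ∀ p : Set V × Set V, IsSep G p → sepOrder p < k → X ⊆ p.1 ∨ X ⊆ p.2

/-- `X` is a `k`-block of `G`: a maximal `(<k)`-inseparable set of at least `k` vertices. -/
def IsBlock (G : SimpleGraph V) (k : ℕ) (X : Set V) : Prop :=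
  k ≤ X.ncard ∧ Inseparable' G k X ∧
    ∀ Y, Inseparable' G k Y → X ⊆ Y → Y = X

/-- The `k`-profile `P_k(X)` induced by a `k`-block `X`. -/
def blockProfile (G : SimpleGraph V) (k : ℕ) (X : Set V) : Set (Set V × Set V) :=
  {p | p ∈ Sk G k ∧ X ⊆ p.2 ∧ ¬X ⊆ p.1}

/-- `p` is a `≤`-maximal element of `M`. -/
def MaxIn (M : Set (Set V × Set V)) (p : Set V × Set V) : Prop :=
  p ∈ M ∧ ∀ q ∈ M, SepLE p q → q = p

/-- The `k`-block `X` is well separated in `S`: the maximal elements of `P_k(X) ∩ S`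
are pairwise nested. -/
def WellSepIn (G : SimpleGraph V) (k : ℕ) (X : Set V) (S : Set (Set V × Set V)) : Prop :=
  ∀ p q, MaxIn (blockProfile G k X ∩ S) p → MaxIn (blockProfile G k X ∩ S) q → Nested p q

/-- `D` is the vertex set of a component of `G - X`. -/
def IsCompOf (G : SimpleGraph V) (X D : Set V) : Prop :=
  D ⊆ Xᶜ ∧ (G.induce D).Connected ∧
    ∀ D', D ⊆ D' → D' ⊆ Xᶜ → (G.induce D').Connected → D' = D

/-- `S(X)`: the set of tight separations `(A,B)` with `X ⊆ B` and `A∖B` the vertex set of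
a component of `G - X`. -/
def SX (G : SimpleGraph V) (X : Set V) : Set (Set V × Set V) :=
  {p | IsSep G p ∧ TightSep G p ∧ X ⊆ p.2 ∧ IsCompOf G X (p.1 \ p.2)}

/-- `G` is `m`-connected. -/
def IsKConnected (G : SimpleGraph V) [Fintype V] (m : ℕ) : Prop :=
  m < Fintype.card V ∧ ∀ U : Set V, U.ncard < m → (G.induce Uᶜ).Connected

/-- The tree-decomposition distinguishes the set `Profs` of profiles. -/
def DistinguishesProfiles (T : SimpleGraph ι) (Vt : ι → Set V)
    (Profs : Set (Set (Set V × Set V))) : Prop :=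
  ∀ P ∈ Profs, ∀ P' ∈ Profs, P ≠ P' → ∃ p ∈ inducedSeps T Vt, p ∈ P ∧ p.swap ∈ P'

/-- The tree-decomposition distinguishes every two distinct `k`-blocks efficiently. -/
def DistinguishesBlocksEff (G : SimpleGraph V) (k : ℕ) (T : SimpleGraph ι)
    (Vt : ι → Set V) : Prop :=
  ∀ X X', IsBlock G k X → IsBlock G k X' → X ≠ X' →
    ∃ p ∈ inducedSeps T Vt, X ⊆ p.1 ∧ X' ⊆ p.2 ∧
      ∀ q : Set V × Set V, IsSep G q → X ⊆ q.1 → X' ⊆ q.2 → sepOrder p ≤ sepOrder q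

/-! ### The order on separations -/

theorem SepLE.refl (p : Set V × Set V) : SepLE p p := ⟨subset_rfl, subset_rfl⟩

theorem SepLE.trans {p q r : Set V × Set V} (h : SepLE p q) (h' : SepLE q r) : SepLE p r :=
  ⟨h.1.trans h'.1, h'.2.trans h.2⟩

theorem SepLE.antisymm {p q : Set V × Set V} (h : SepLE p q) (h' : SepLE q p) : p = q :=
  Prod.ext (h.1.antisymm h'.1) (h'.2.antisymm h.2)

theorem Nested.symm {p q : Set V × Set V} (h : Nested p q) : Nested q p := by
  rcases h with h | h | h | h
  · exact .inr (.inl h)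
  · exact .inl h
  · exact .inr (.inr (.inl ⟨h.2, h.1⟩))
  · exact .inr (.inr (.inr ⟨h.2, h.1⟩))

theorem Nested.swap_right {p q : Set V × Set V} (h : Nested p q) : Nested p q.swap := by
  rcases h with h | h | h | h
  · exact .inr (.inr (.inl h))
  · exact .inr (.inr (.inr h))
  · exact .inl h
  · exact .inr (.inl h)

theorem nested_swap_right {p q : Set V × Set V} : Nested p q.swap ↔ Nested p q :=
  ⟨fun h => h.swap_right, fun h => h.swap_right⟩

theorem nested_swap_left {p q : Set V × Set V} : Nested p.swap q ↔ Nested p q :=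
  ⟨fun h => (nested_swap_right.1 h.symm).symm, fun h => h.symm.swap_right.symm⟩

theorem IsSep.swap {G : SimpleGraph V} {p : Set V × Set V} (h : IsSep G p) : IsSep G p.swap :=
  ⟨(union_comm _ _).trans h.1, fun a ha b hb hab => h.2 b hb a ha hab.symm⟩

theorem ProperSep.swap {p : Set V × Set V} (h : ProperSep p) : ProperSep p.swap := ⟨h.2, h.1⟩

theorem TightSep.swap {G : SimpleGraph V} {p : Set V × Set V} (h : TightSep G p) :
    TightSep G p.swap := fun v hv => (h v ⟨hv.2, hv.1⟩).symm

theorem sepOrder_swap (p : Set V × Set V) : sepOrder p.swap = sepOrder p := by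
  simp [sepOrder, inter_comm]

theorem ProperSep.not_swap_le {p : Set V × Set V} (h : ProperSep p) : ¬SepLE p.swap p :=
  fun h' => let ⟨_, hx⟩ := h.2; hx.2 (h'.1 hx.1)

/-! ### The tree of a nested system of separations -/

/-- A nested symmetric set of proper separations. -/
structure IsTreeSystem (G : SimpleGraph V) (N : Set (Set V × Set V)) : Prop where
  sep : ∀ p ∈ N, IsSep G p
  swap : ∀ p ∈ N, p.swap ∈ N
  nested : ∀ p ∈ N, ∀ q ∈ N, Nested p q
  proper : ∀ p ∈ N, ProperSep p

/-- The nodes of the tree of `N`: orientations of `N` that are closed downwards. -/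
structure IsNode (N O : Set (Set V × Set V)) : Prop where
  subset : O ⊆ N
  orient : ∀ p ∈ N, (p ∈ O ↔ p.swap ∉ O)
  down : ∀ q ∈ O, ∀ p ∈ N, SepLE p q → p ∈ O

theorem IsNode.swap_mem {N O : Set (Set V × Set V)} (hO : IsNode N O) {p : Set V × Set V}
    (hp : p ∈ N) (h : p ∉ O) : p.swap ∈ O := by
  by_contra h'
  exact h ((hO.orient p hp).2 h')

theorem IsNode.swap_notMem {N O : Set (Set V × Set V)} (hO : IsNode N O) {p : Set V × Set V}
    (h : p ∈ O) : p.swap ∉ O :=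
  (hO.orient p (hO.subset h)).1 h

theorem IsNode.eq_of_subset {N O O' : Set (Set V × Set V)} (hO : IsNode N O) (hO' : IsNode N O')
    (h : O ⊆ O') : O = O' := by
  refine h.antisymm fun p hp => ?_
  by_contra hpO
  exact hO'.swap_notMem hp (h (hO.swap_mem (hO'.subset hp) hpO))

/-- Reversing a maximal separation of a node yields a node. -/
theorem IsNode.flip {G : SimpleGraph V} {N O : Set (Set V × Set V)} (hN : IsTreeSystem G N)
    (hO : IsNode N O) {p : Set V × Set V} (hp : p ∈ O) (hmax : ∀ q ∈ O, SepLE p q → q = p) :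
    IsNode N (insert p.swap (O \ {p})) := by
  have hpN := hO.subset hp
  have hne : p.swap ≠ p := fun h => hO.swap_notMem hp (h.symm ▸ hp)
  refine ⟨?_, fun q hq => ?_, ?_⟩
  · rintro q (rfl | hq)
    · exact hN.swap p hpN
    · exact hO.subset hq.1
  · by_cases h1 : q = p
    · subst h1
      simp [hne.symm]
    by_cases h2 : q = p.swap
    · subst h2
      simp [hne.symm]
    have h3 : q.swap ≠ p := fun h => h2 (by rw [← h, Prod.swap_swap])
    have h4 : q.swap ≠ p.swap := fun h => h1 (Prod.swap_injective h)
    simp [h1, h2, h3, h4, hO.orient q hq]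
  · rintro q (rfl | hq) r hr hrq
    · by_cases h : r = p.swap
      · exact .inl h
      refine .inr ⟨?_, ?_⟩
      · by_contra hrO
        have h' := hmax _ (hO.swap_mem hr hrO) ⟨hrq.2, hrq.1⟩
        exact h (by rw [← h', Prod.swap_swap])
      · rintro rfl
        exact (hN.proper _ hpN).swap.not_swap_le hrq
    · refine .inr ⟨hO.down q hq.1 r hr hrq, ?_⟩
      rintro rfl
      exact hq.2 (hmax q hq.1 hrq)

theorem IsTreeSystem.exists_node {G : SimpleGraph V} {N : Set (Set V × Set V)}
    (hN : IsTreeSystem G N) : ∃ O, IsNode N O := by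
  rcases N.eq_empty_or_nonempty with rfl | ⟨p, hp⟩
  · exact ⟨∅, by simp, by simp, by simp⟩
  have hpp := hN.proper p hp
  refine ⟨{q ∈ N | SepLE q p ∨ (SepLE q p.swap ∧ q ≠ p.swap)}, fun q hq => hq.1,
    fun q hq => ⟨?_, fun h => ?_⟩, ?_⟩
  · rintro ⟨-, h⟩ ⟨-, h'⟩
    rcases h with h | h <;> rcases h' with h' | h'
    · exact hpp.not_swap_le (SepLE.trans (q := q) ⟨h'.2, h'.1⟩ h)
    · refine h'.2 ?_
      rw [h.antisymm ⟨h'.1.2, h'.1.1⟩]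
    · refine h.2 (h.1.antisymm ⟨h'.2, h'.1⟩)
    · exact hpp.swap.not_swap_le (SepLE.trans (q := q) ⟨h'.1.2, h'.1.1⟩ h.1)
  · refine ⟨hq, ?_⟩
    by_contra h'
    simp only [not_or, not_and, not_not] at h'
    refine h ⟨hN.swap q hq, ?_⟩
    rcases hN.nested q hq p hp with h1 | h1 | h1 | h1
    · exact absurd h1 h'.1
    · refine .inr ⟨⟨h1.2, h1.1⟩, fun h2 => h'.1 ?_⟩
      rw [Prod.swap_injective h2]
      exact .refl _
    · rw [h'.2 h1]
      exact .inl (.refl _)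
    · exact .inl ⟨h1.2, h1.1⟩
  · rintro q ⟨hq, h | h⟩ r hr hrq
    · exact ⟨hr, .inl (hrq.trans h)⟩
    · refine ⟨hr, .inr ⟨hrq.trans h.1, ?_⟩⟩
      rintro rfl
      exact h.2 (h.1.antisymm hrq)

/-- The part of a node: the vertices to which all its separations point. -/
def part (O : Set (Set V × Set V)) : Set V := {v | ∀ p ∈ O, v ∈ p.2}

theorem exists_maximal_above [Finite V] (P : Set V × Set V → Prop) {p : Set V × Set V} (hp : P p) :
    ∃ q, P q ∧ SepLE p q ∧ ∀ r, P r → SepLE q r → r = q := by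
  let le : PartialOrder (Set V × Set V) :=
    { le := SepLE
      lt := fun p q => SepLE p q ∧ ¬SepLE q p
      le_refl := .refl
      le_trans := fun _ _ _ => .trans
      le_antisymm := fun _ _ => SepLE.antisymm
      lt_iff_le_not_ge := fun _ _ => Iff.rfl }
  obtain ⟨q, hpq, hq⟩ :=
    @Set.Finite.exists_le_maximal _ le.toPreorder {r | P r} p (toFinite _) hp
  exact ⟨q, hq.1, hpq, fun r hr hqr => SepLE.antisymm (hq.2 hr hqr) hqr⟩

/-- A set that no separation of `N` splits lies in the part of some node. -/
theorem IsTreeSystem.exists_subset_part [Finite V] {G : SimpleGraph V} {N : Set (Set V × Set V)}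
    (hN : IsTreeSystem G N) {W : Set V} (hW : ∀ p ∈ N, W ⊆ p.1 ∨ W ⊆ p.2)
    {R : Set (Set V × Set V)} (hR : ∀ p ∈ R, W ⊆ p.2) {O : Set (Set V × Set V)}
    (hO : IsNode N O) (hRO : R ⊆ O) : ∃ O', IsNode N O' ∧ R ⊆ O' ∧ W ⊆ part O' := by
  induction hn : {q ∈ O | ¬W ⊆ q.2}.ncard using Nat.strong_induction_on generalizing O with
  | _ n ih =>
  by_cases hbad : ∃ q ∈ O, ¬W ⊆ q.2
  swap
  · push Not at hbad
    exact ⟨O, hO, hRO, fun v hv p hp => hbad p hp hv⟩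
  obtain ⟨p, hp, hpW⟩ := hbad
  obtain ⟨q, hq, hpq, hmax⟩ := exists_maximal_above (· ∈ O) hp
  have hqW : ¬W ⊆ q.2 := fun h => hpW (h.trans hpq.2)
  have hqW' : W ⊆ q.1 := (hW q (hO.subset hq)).resolve_right hqW
  refine ih _ ?_ (hO.flip hN hq hmax) (fun r hr => .inr ⟨hRO hr, ?_⟩) rfl
  · rw [← hn]
    refine Set.ncard_lt_ncard ⟨?_, fun h => ?_⟩ (toFinite _)
    · rintro r ⟨rfl | hr, hrW⟩
      · exact absurd hqW' hrW
      · exact ⟨hr.1, hrW⟩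
    · rcases (h ⟨hq, hqW⟩).1 with h' | h'
      · rw [h'] at hqW
        exact hqW hqW'
      · exact h'.2 rfl
  · rintro rfl
    exact hqW (hR _ hr)

section Tree

variable {G : SimpleGraph V} {N : Set (Set V × Set V)} (e : ι ≃ {O // IsNode N O})

/-- The tree of `N`: two nodes are adjacent when they differ in one separation. -/
def nodeTree : SimpleGraph ι where
  Adj i j := ∃ p ∈ (e i).1, p ∉ (e j).1 ∧ ∀ q ∈ (e i).1, q ≠ p → q ∈ (e j).1
  symm := ⟨by
    rintro i j ⟨p, hp, hpj, h⟩
    refine ⟨p.swap, (e j).2.swap_mem ((e i).2.subset hp) hpj, (e i).2.swap_notMem hp,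
      fun q hq hqp => ?_⟩
    by_contra hqi
    refine (e j).2.swap_notMem hq (h _ ((e i).2.swap_mem ((e j).2.subset hq) hqi) fun h' => ?_)
    exact hqp (by rw [← h', Prod.swap_swap])⟩
  loopless := ⟨fun i ⟨_, hp, hpi, _⟩ => hpi hp⟩

theorem nodeTree_exists_step [Finite V] (hN : IsTreeSystem G N) {i j : ι} (hij : i ≠ j) :
    ∃ l, (nodeTree e).Adj i l ∧ ((e l).1 \ (e j).1).ncard < ((e i).1 \ (e j).1).ncard ∧
      (e i).1 ∩ (e j).1 ⊆ (e l).1 := by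
  have : ∃ p, p ∈ (e i).1 \ (e j).1 := by
    by_contra! h
    refine hij (e.injective (Subtype.ext ((e i).2.eq_of_subset (e j).2 fun p hp => ?_)))
    by_contra hpj
    exact h p ⟨hp, hpj⟩
  obtain ⟨p, hp⟩ := this
  obtain ⟨q, hq, -, hmax⟩ := exists_maximal_above (· ∈ (e i).1 \ (e j).1) hp
  have hmax' : ∀ r ∈ (e i).1, SepLE q r → r = q := fun r hr hqr =>
    hmax r ⟨hr, fun hrj => hq.2 ((e j).2.down r hrj q ((e i).2.subset hq.1) hqr)⟩ hqr
  have hfl := (e i).2.flip hN hq.1 hmax'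
  have hne : q ≠ q.swap := fun h => (e i).2.swap_notMem hq.1 (h ▸ hq.1)
  refine ⟨e.symm ⟨_, hfl⟩, ⟨q, hq.1, ?_, fun r hr hrq => ?_⟩, ?_, ?_⟩
  · simp [hne]
  · simp [hr, hrq]
  · refine Set.ncard_lt_ncard ⟨?_, fun h => ?_⟩ (toFinite _)
    · simp only [Equiv.apply_symm_apply]
      rintro r ⟨rfl | hr, hrj⟩
      · exact absurd ((e j).2.swap_mem ((e i).2.subset hq.1) hq.2) hrj
      · exact ⟨hr.1, hrj⟩
    · have := (h hq).1
      simp [hne] at this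
  · simp only [Equiv.apply_symm_apply]
    exact fun r hr => .inr ⟨hr.1, fun h => hq.2 (h ▸ hr.2)⟩

theorem nodeTree_reachable [Finite V] (hN : IsTreeSystem G N) {R : Set (Set V × Set V)}
    {H : SimpleGraph ι}
    (hH : ∀ i j, (nodeTree e).Adj i j → R ⊆ (e i).1 → R ⊆ (e j).1 → H.Adj i j) {i j : ι}
    (hi : R ⊆ (e i).1) (hj : R ⊆ (e j).1) : H.Reachable i j := by
  induction hn : ((e i).1 \ (e j).1).ncard using Nat.strong_induction_on generalizing i with
  | _ n ih =>
  by_cases hij : i = j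
  · rw [hij]
  obtain ⟨l, hil, hlt, hsub⟩ := nodeTree_exists_step e hN hij
  have hl : R ⊆ (e l).1 := fun p hp => hsub ⟨hi hp, hj hp⟩
  exact (hH i l hil hi hl).reachable.trans (ih _ (hn ▸ hlt) hl rfl)

theorem nodeTree_max {i j : ι} (h : (nodeTree e).Adj i j) {p : Set V × Set V}
    (hi : p ∈ (e i).1) (hj : p ∉ (e j).1) : ∀ q ∈ (e i).1, SepLE p q → q = p := by
  obtain ⟨r, hr, hrj, hr'⟩ := h
  obtain rfl : p = r := by
    by_contra hpr
    exact hj (hr' p hi hpr)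
  intro q hq hpq
  by_contra hqp
  exact hj ((e j).2.down q (hr' q hq hqp) p ((e i).2.subset hi) hpq)

theorem IsNode.eq_of_max {O O' : Set (Set V × Set V)} (hN : IsTreeSystem G N) (hO : IsNode N O)
    (hO' : IsNode N O') {p : Set V × Set V} (hp : p ∈ O) (hp' : p ∈ O')
    (hmax : ∀ q ∈ O, SepLE p q → q = p) (hmax' : ∀ q ∈ O', SepLE p q → q = p) : O = O' := by
  refine hO.eq_of_subset hO' fun q hq => ?_
  have hqN := hO.subset hq
  rcases hN.nested q hqN p (hO.subset hp) with h | h | h | h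
  · exact hO'.down p hp' q hqN h
  · rwa [hmax q hq h]
  · by_contra hq'
    have := hmax' _ (hO'.swap_mem hqN hq') ⟨h.2, h.1⟩
    exact hO.swap_notMem hq (this ▸ hp)
  · exact absurd (hO.down p hp q.swap (hN.swap q hqN) ⟨h.2, h.1⟩) (hO.swap_notMem hq)

theorem nodeTree_edge_unique (hN : IsTreeSystem G N) {i j i' j' : ι} (h : (nodeTree e).Adj i j)
    (h' : (nodeTree e).Adj i' j') {p : Set V × Set V} (hi : p ∈ (e i).1) (hj : p ∉ (e j).1)
    (hi' : p ∈ (e i').1) (hj' : p ∉ (e j').1) : i = i' ∧ j = j' := by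
  have hpN := (e i).2.subset hi
  have hs := (e i).2.swap_notMem hi
  have hs' := (e i').2.swap_notMem hi'
  have hsj := (e j).2.swap_mem hpN hj
  have hsj' := (e j').2.swap_mem hpN hj'
  refine ⟨e.injective (Subtype.ext ?_), e.injective (Subtype.ext ?_)⟩
  · exact (e i).2.eq_of_max hN (e i').2 hi hi' (nodeTree_max e h hi hj) (nodeTree_max e h' hi' hj')
  · exact (e j).2.eq_of_max hN (e j').2 hsj hsj' (nodeTree_max e h.symm hsj hs)
      (nodeTree_max e h'.symm hsj' hs')

theorem nodeTree_deleteEdges_reachable [Finite V] (hN : IsTreeSystem G N) {i j : ι}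
    (h : (nodeTree e).Adj i j) {p : Set V × Set V} (hi : p ∈ (e i).1) (hj : p ∉ (e j).1)
    {a b : ι} :
    ((nodeTree e).deleteEdges {s(i, j)}).Reachable a b ↔ (p ∈ (e a).1 ↔ p ∈ (e b).1) := by
  have hadj : ∀ a b, ((nodeTree e).deleteEdges {s(i, j)}).Adj a b →
      (p ∈ (e a).1 ↔ p ∈ (e b).1) := by
    intro a b hab
    rw [deleteEdges_adj, mem_singleton_iff] at hab
    by_contra hne
    by_cases ha : p ∈ (e a).1
    · have hb : p ∉ (e b).1 := fun hb => hne ⟨fun _ => hb, fun _ => ha⟩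
      obtain ⟨rfl, rfl⟩ := nodeTree_edge_unique e hN h hab.1 hi hj ha hb
      exact hab.2 rfl
    · have hb : p ∈ (e b).1 := by tauto
      obtain ⟨rfl, rfl⟩ := nodeTree_edge_unique e hN h hab.1.symm hi hj hb ha
      exact hab.2 Sym2.eq_swap
  have hpN := (e i).2.subset hi
  constructor
  · rw [reachable_iff_reflTransGen]
    intro hab
    induction hab with
    | refl => rfl
    | tail _ hbc ih => exact ih.trans (hadj _ _ hbc)
  · intro hab
    by_cases ha : p ∈ (e a).1
    · refine nodeTree_reachable e hN (R := {p}) (fun c d hcd hc hd => ?_)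
        (singleton_subset_iff.2 ha) (singleton_subset_iff.2 (hab.1 ha))
      rw [singleton_subset_iff] at hc hd
      rw [deleteEdges_adj, mem_singleton_iff, Sym2.eq_iff]
      refine ⟨hcd, ?_⟩
      rintro (⟨rfl, rfl⟩ | ⟨rfl, rfl⟩)
      exacts [hj hd, hj hc]
    · have hb : p ∉ (e b).1 := fun hb => ha (hab.2 hb)
      refine nodeTree_reachable e hN (R := {p.swap}) (fun c d hcd hc hd => ?_)
        (singleton_subset_iff.2 ((e a).2.swap_mem hpN ha))
        (singleton_subset_iff.2 ((e b).2.swap_mem hpN hb))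
      rw [singleton_subset_iff] at hc hd
      rw [deleteEdges_adj, mem_singleton_iff, Sym2.eq_iff]
      refine ⟨hcd, ?_⟩
      rintro (⟨rfl, rfl⟩ | ⟨rfl, rfl⟩)
      exacts [(e _).2.swap_notMem hi hc, (e _).2.swap_notMem hi hd]

theorem nodeTree_isTree [Finite V] (hN : IsTreeSystem G N) : (nodeTree e).IsTree := by
  obtain ⟨O, hO⟩ := hN.exists_node
  have : Nonempty ι := ⟨e.symm ⟨O, hO⟩⟩
  refine ⟨⟨fun i j => nodeTree_reachable e hN (R := ∅) (fun _ _ h _ _ => h) (empty_subset _)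
    (empty_subset _)⟩, ?_⟩
  rw [isAcyclic_iff_forall_adj_isBridge]
  intro i j hij
  obtain ⟨p, hi, hj, -⟩ := id hij
  rw [isBridge_iff]
  exact fun h => hj (((nodeTree_deleteEdges_reachable e hN hij hi hj).1 h).1 hi)

theorem nodeTree_inducedSep [Finite V] (hN : IsTreeSystem G N) {i j : ι}
    (h : (nodeTree e).Adj i j) {p : Set V × Set V} (hi : p ∈ (e i).1) (hj : p ∉ (e j).1) :
    inducedSep (nodeTree e) (fun l => part (e l).1) i j = p.swap := by
  have hpN := (e i).2.subset hi
  have key : ∀ q ∈ N, ∀ l, q ∈ (e l).1 → ∀ v ∈ q.2, ∃ m, q ∈ (e m).1 ∧ v ∈ part (e m).1 := by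
    intro q hq l hl v hv
    obtain ⟨O, hO, hqO, hvO⟩ := hN.exists_subset_part (W := {v}) (R := {q})
      (fun r hr => by
        have : v ∈ r.1 ∪ r.2 := (hN.sep r hr).1 ▸ mem_univ v
        simpa using this)
      (by simpa using hv) (e l).2 (by simpa using hl)
    refine ⟨e.symm ⟨O, hO⟩, ?_, ?_⟩
    · simpa using hqO
    · simpa using hvO
  have hsj := (e j).2.swap_mem hpN hj
  refine Prod.ext (Set.ext fun v => ?_) (Set.ext fun v => ?_)
  · simp only [inducedSep, side, mem_iUnion, mem_ofPred_eq, Prod.fst_swap, exists_prop,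
      nodeTree_deleteEdges_reachable e hN h hi hj, hi, true_iff]
    exact ⟨fun ⟨l, hl, hv⟩ => hv p hl, fun hv => key p hpN i hi v hv⟩
  · rw [Prod.snd_swap]
    simp only [inducedSep, side, mem_iUnion, mem_ofPred_eq, exists_prop, Sym2.eq_swap (a := j),
      nodeTree_deleteEdges_reachable e hN h hi hj, hj, false_iff]
    constructor
    · exact fun ⟨l, hl, hv⟩ => hv _ ((e l).2.swap_mem hpN hl)
    · intro hv
      obtain ⟨m, hm, hv'⟩ := key _ (hN.swap p hpN) j hsj v hv
      exact ⟨m, fun h' => (e m).2.swap_notMem h' hm, hv'⟩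

theorem nodeTree_isTreeDecomp [Finite V] (hN : IsTreeSystem G N) :
    IsTreeDecomp G (nodeTree e) (fun l => part (e l).1) := by
  obtain ⟨O, hO⟩ := hN.exists_node
  have key : ∀ W : Set V, (∀ p ∈ N, W ⊆ p.1 ∨ W ⊆ p.2) → ∃ t, W ⊆ part (e t).1 := by
    intro W hW
    obtain ⟨O', hO', -, h⟩ := hN.exists_subset_part hW (R := ∅) (by simp) hO (empty_subset _)
    exact ⟨e.symm ⟨O', hO'⟩, by simpa using h⟩
  have hmem : ∀ p ∈ N, ∀ v, v ∈ p.1 ∨ v ∈ p.2 := fun p hp v => by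
    have : v ∈ p.1 ∪ p.2 := (hN.sep p hp).1 ▸ mem_univ v
    exact this
  refine ⟨nodeTree_isTree e hN, ?_, fun u v huv => ?_, ?_⟩
  · refine eq_univ_of_forall fun v => ?_
    obtain ⟨t, ht⟩ := key {v} fun p hp => by simpa using hmem p hp v
    exact mem_iUnion.2 ⟨t, by simpa using ht⟩
  · obtain ⟨t, ht⟩ := key {u, v} fun p hp => by
      simp only [insert_subset_iff, singleton_subset_iff]
      have h1 := (hN.sep p hp).2 u
      have h2 := (hN.sep p hp).2 v
      have h3 := hmem p hp u
      have h4 := hmem p hp v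
      have h5 := huv.symm
      simp only [mem_sdiff] at h1 h2
      by_contra h6
      grind
    exact ⟨t, ht (by simp), ht (by simp)⟩
  · classical
    rintro t1 t3 w hw t2 ht2 v ⟨hv1, hv3⟩ p hp
    by_contra hv
    have h1 : p ∉ (e t1).1 := fun h => hv (hv1 p h)
    have h3 : p ∉ (e t3).1 := fun h => hv (hv3 p h)
    obtain ⟨d1, hd1, hf1, hs1⟩ := (w.takeUntil t2 ht2).exists_boundary_dart
      {i | p ∉ (e i).1} h1 (by simpa using hp)
    obtain ⟨d2, hd2, hf2, hs2⟩ := (w.dropUntil t2 ht2).exists_boundary_dart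
      {i | p ∈ (e i).1} hp h3
    obtain ⟨h4, h5⟩ := nodeTree_edge_unique e hN d1.adj.symm d2.adj (by simpa using hs1) hf1 hf2 hs2
    have hnd := hw.isTrail.edges_nodup
    rw [← w.take_spec ht2, Walk.edges_append, List.nodup_append] at hnd
    refine hnd.2.2 _ (List.mem_map_of_mem hd1) _ (List.mem_map_of_mem hd2) ?_
    rw [dart_edge_eq_iff]
    right
    ext <;> simp [h4, h5]

end Tree

/-! ### The action of a graph automorphism on separations -/

/-- The image of a separation under an automorphism. -/
def act {G : SimpleGraph V} (φ : G ≃g G) (p : Set V × Set V) : Set V × Set V :=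
  (φ '' p.1, φ '' p.2)

section Action

variable {G : SimpleGraph V}

theorem act_trans (φ ψ : G ≃g G) (p : Set V × Set V) : act (φ.trans ψ) p = act ψ (act φ p) := by
  simp [act, image_image]

theorem act_symm_act (φ : G ≃g G) (p : Set V × Set V) : act φ.symm (act φ p) = p := by
  simp [act, image_image]

theorem act_act_symm (φ : G ≃g G) (p : Set V × Set V) : act φ (act φ.symm p) = p := by
  simp [act, image_image]

theorem SepLE.act {p q : Set V × Set V} (h : SepLE p q) (φ : G ≃g G) :
    SepLE (act φ p) (act φ q) := ⟨image_mono h.1, image_mono h.2⟩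

theorem Nested.act {p q : Set V × Set V} (h : Nested p q) (φ : G ≃g G) :
    Nested (act φ p) (act φ q) :=
  h.imp (·.act φ) (.imp (·.act φ) (.imp (·.act φ) (·.act φ)))

theorem IsSep.act {p : Set V × Set V} (h : IsSep G p) (φ : G ≃g G) : IsSep G (act φ p) := by
  refine ⟨?_, ?_⟩
  · rw [CanonicalTD.act, ← image_union, h.1, image_univ, φ.surjective.range_eq]
  · simp only [CanonicalTD.act, ← image_sdiff φ.injective]
    rintro _ ⟨a, ha, rfl⟩ _ ⟨b, hb, rfl⟩
    exact fun hab => h.2 a ha b hb (φ.map_adj_iff.1 hab)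

theorem ProperSep.act {p : Set V × Set V} (h : ProperSep p) (φ : G ≃g G) :
    ProperSep (act φ p) := by
  simp only [ProperSep, CanonicalTD.act, ← image_sdiff φ.injective]
  exact ⟨h.1.image _, h.2.image _⟩

theorem TightSep.act {p : Set V × Set V} (h : TightSep G p) (φ : G ≃g G) :
    TightSep G (act φ p) := by
  simp only [TightSep, CanonicalTD.act, ← image_sdiff φ.injective, ← image_inter φ.injective]
  rintro _ ⟨v, hv, rfl⟩
  obtain ⟨⟨a, ha, hva⟩, b, hb, hvb⟩ := h v hv
  exact ⟨⟨_, mem_image_of_mem _ ha, φ.map_adj_iff.2 hva⟩, _, mem_image_of_mem _ hb,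
    φ.map_adj_iff.2 hvb⟩

theorem sepOrder_act (φ : G ≃g G) (p : Set V × Set V) : sepOrder (act φ p) = sepOrder p := by
  rw [sepOrder, act, ← image_inter φ.injective, ncard_image_of_injective _ φ.injective, sepOrder]

theorem IsBlock.act {k : ℕ} {X : Set V} (h : IsBlock G k X) (φ : G ≃g G) :
    IsBlock G k (φ '' X) := by
  have key : ∀ (φ : G ≃g G) (Y : Set V), Inseparable' G k Y → Inseparable' G k (φ '' Y) := by
    intro φ Y hY p hp hpk
    have := hY _ (hp.act φ.symm) (by rwa [sepOrder_act])
    rw [← act_act_symm φ p]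
    exact this.imp (image_mono ·) (image_mono ·)
  refine ⟨by rw [ncard_image_of_injective _ φ.injective]; exact h.1, key φ X h.2.1,
    fun Y hY hXY => ?_⟩
  have h1 := h.2.2 _ (key φ.symm Y hY) (by
    rintro x hx
    exact ⟨φ x, hXY (mem_image_of_mem _ hx), by simp⟩)
  rw [← h1]
  simp [image_image]

/-- The action of an automorphism on the nodes of an invariant system. -/
def nodeAct {N : Set (Set V × Set V)} (hN : ∀ (φ : G ≃g G), ∀ p ∈ N, act φ p ∈ N) (φ : G ≃g G) :
    {O // IsNode N O} ≃ {O // IsNode N O} where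
  toFun O := ⟨act φ.symm ⁻¹' O.1,
    fun p hp => act_act_symm φ p ▸ hN φ _ (O.2.subset hp),
    fun p hp => O.2.orient _ (hN _ p hp),
    fun q hq p hp hpq => O.2.down _ hq _ (hN _ p hp) (hpq.act _)⟩
  invFun O := ⟨act φ ⁻¹' O.1,
    fun p hp => act_symm_act φ p ▸ hN φ.symm _ (O.2.subset hp),
    fun p hp => O.2.orient _ (hN _ p hp),
    fun q hq p hp hpq => O.2.down _ hq _ (hN _ p hp) (hpq.act _)⟩
  left_inv O := Subtype.ext (Set.ext fun p => by simp [act_symm_act])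
  right_inv O := Subtype.ext (Set.ext fun p => by simp [act_act_symm])

theorem mem_nodeAct {N : Set (Set V × Set V)} (hN : ∀ (φ : G ≃g G), ∀ p ∈ N, act φ p ∈ N)
    (φ : G ≃g G) (O : {O // IsNode N O}) (p : Set V × Set V) :
    p ∈ (nodeAct hN φ O).1 ↔ act φ.symm p ∈ O.1 := Iff.rfl

theorem nodeTree_canonical {N : Set (Set V × Set V)} (e : ι ≃ {O // IsNode N O})
    (hN : ∀ (φ : G ≃g G), ∀ p ∈ N, act φ p ∈ N) :
    Canonical G (nodeTree e) (fun l => part (e l).1) := by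
  have hadj : ∀ φ i j, (nodeTree e).Adj i j →
      (nodeTree e).Adj (e.symm (nodeAct hN φ (e i))) (e.symm (nodeAct hN φ (e j))) := by
    rintro φ i j ⟨p, hp, hpj, h⟩
    simp only [nodeTree, Equiv.apply_symm_apply, mem_nodeAct]
    refine ⟨act φ p, by rwa [act_symm_act], by rwa [act_symm_act], fun q hq hqp => h _ hq ?_⟩
    rintro rfl
    exact hqp (act_act_symm φ q).symm
  have hsymm : ∀ φ i, nodeAct hN φ.symm (nodeAct hN φ i) = i := fun φ i => by
    refine Subtype.ext (Set.ext fun p => ?_)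
    rw [mem_nodeAct, mem_nodeAct]
    exact iff_of_eq (congrArg (· ∈ i.1) (act_symm_act φ p))
  refine ⟨fun φ => ⟨(e.trans (nodeAct hN φ)).trans e.symm, fun {i j} => ⟨fun h => ?_, hadj φ i j⟩⟩,
    fun φ ψ => ?_, fun φ t => ?_⟩
  · simpa [hsymm] using hadj φ.symm _ _ h
  · ext i
    simp only [RelIso.coe_fn_mk, RelIso.trans_apply, Equiv.trans_apply, Equiv.apply_symm_apply]
    refine congrArg e.symm (Subtype.ext (Set.ext fun p => ?_))
    simp only [mem_nodeAct]
    exact iff_of_eq (congrArg (· ∈ (e i).1) (act_trans ψ.symm φ.symm p))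
  · ext v
    simp only [RelIso.coe_fn_mk, Equiv.trans_apply, Equiv.apply_symm_apply, part, mem_ofPred_eq,
      mem_nodeAct]
    constructor
    · rintro ⟨u, hu, rfl⟩ p hp
      obtain ⟨w, hw, hwu⟩ := hu _ hp
      rw [← hwu]
      simpa using hw
    · intro h
      refine ⟨φ.symm v, fun p hp => ?_, by simp⟩
      obtain ⟨w, hw, rfl⟩ := h (act φ p) (by rwa [act_symm_act])
      simpa using hw

end Action

/-! ### Tight separations -/

section Blocks

variable {G : SimpleGraph V} {k : ℕ}

/-- The tight separations in `S_k`. -/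
def tightSeps (G : SimpleGraph V) (k : ℕ) : Set (Set V × Set V) := {p | p ∈ Sk G k ∧ TightSep G p}

theorem swap_mem_tightSeps {p : Set V × Set V} (hp : p ∈ tightSeps G k) :
    p.swap ∈ tightSeps G k :=
  ⟨⟨hp.1.1.swap, hp.1.2.1.swap, by rw [sepOrder_swap]; exact hp.1.2.2⟩, hp.2.swap⟩

theorem act_mem_tightSeps {p : Set V × Set V} (hp : p ∈ tightSeps G k) (φ : G ≃g G) :
    act φ p ∈ tightSeps G k :=
  ⟨⟨hp.1.1.act φ, hp.1.2.1.act φ, by rw [sepOrder_act]; exact hp.1.2.2⟩, hp.2.act φ⟩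

/-- The least separation of `G` with second side `B`. -/
def trim (G : SimpleGraph V) (B : Set V) : Set V × Set V := ({u | ∃ a ∉ B, u = a ∨ G.Adj u a}, B)

theorem trim_isSep (B : Set V) : IsSep G (trim G B) := by
  refine ⟨eq_univ_of_forall fun v => ?_, fun a ha b hb hab => ?_⟩
  · by_cases hv : v ∈ B
    · exact .inr hv
    · exact .inl ⟨v, hv, .inl rfl⟩
  · exact hb.2 ⟨a, ha.2, .inr hab.symm⟩

theorem IsSep.trim_le {p : Set V × Set V} (h : IsSep G p) : SepLE (trim G p.2) p := by
  have hmem : ∀ v ∉ p.2, v ∈ p.1 := fun v hv => by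
    have : v ∈ p.1 ∪ p.2 := h.1 ▸ mem_univ v
    exact this.resolve_right hv
  refine ⟨?_, subset_rfl⟩
  rintro u ⟨a, ha, rfl | hua⟩
  · exact hmem u ha
  · by_contra hu
    have hu2 : u ∈ p.2 := by
      by_contra hu2
      exact hu (hmem u hu2)
    exact h.2 a ⟨hmem a ha, ha⟩ u ⟨hu2, hu⟩ hua.symm

theorem sepOrder_trim_le [Finite V] {p : Set V × Set V} (h : IsSep G p) :
    sepOrder (trim G p.2) ≤ sepOrder p :=
  ncard_le_ncard (inter_subset_inter_left _ h.trim_le.1) (toFinite _)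

theorem trim_anti {B C : Set V} (h : B ⊆ C) : (trim G C).1 ⊆ (trim G B).1 :=
  fun _ ⟨a, ha, hu⟩ => ⟨a, fun haB => ha (h haB), hu⟩

theorem TightSep.eq_trim {p : Set V × Set V} (h : TightSep G p) (hp : IsSep G p) :
    p = trim G p.2 := by
  refine SepLE.antisymm ⟨fun u hu => ?_, subset_rfl⟩ hp.trim_le
  by_cases hu2 : u ∈ p.2
  · obtain ⟨⟨a, ha, hua⟩, -⟩ := h u ⟨hu, hu2⟩
    exact ⟨a, ha.2, .inr hua⟩
  · exact ⟨u, hu2, .inl rfl⟩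

theorem IsBlock.not_subset_inter [Finite V] {X : Set V} (hX : IsBlock G k X) {p : Set V × Set V}
    (hp : sepOrder p < k) (h1 : X ⊆ p.1) (h2 : X ⊆ p.2) : False :=
  absurd (ncard_le_ncard (subset_inter h1 h2) (toFinite _)) (not_le.2 (hp.trans_le hX.1))

/-- Deleting from the second side a vertex without neighbours in its interior. -/
theorem IsSep.erase_snd {p : Set V × Set V} (hp : IsSep G p) {u : V} (hu : u ∈ p.1)
    (hu' : ¬∃ b ∈ p.2 \ p.1, G.Adj u b) : IsSep G (p.1, p.2 \ {u}) := by
  refine ⟨eq_univ_of_forall fun v => ?_, ?_⟩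
  · have : v ∈ p.1 ∪ p.2 := hp.1 ▸ mem_univ v
    by_cases hv : v ∈ p.1
    · exact .inl hv
    · refine .inr ⟨this.resolve_left hv, ?_⟩
      rintro rfl
      exact hv hu
  · rintro a ⟨ha, ha'⟩ b ⟨hb, hb'⟩ hab
    by_cases hau : a = u
    · subst hau
      exact hu' ⟨b, ⟨hb.1, hb'⟩, hab⟩
    · exact hp.2 a ⟨ha, fun h => ha' ⟨h, hau⟩⟩ b ⟨hb.1, hb'⟩ hab

theorem sepOrder_erase_snd [Finite V] {p : Set V × Set V} {u : V} (hu : u ∈ p.1 ∩ p.2) :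
    sepOrder (p.1, p.2 \ {u}) < sepOrder p :=
  ncard_lt_ncard ⟨inter_subset_inter_right _ sdiff_subset, fun h => (h hu).2.2 rfl⟩ (toFinite _)

/-- A block on the second side avoids the vertices that can be deleted from it. -/
theorem IsBlock.subset_erase_snd [Finite V] {X : Set V} (hX : IsBlock G k X) {p : Set V × Set V}
    (hp : IsSep G p) (hpk : sepOrder p < k) (hXp : X ⊆ p.2) {u : V} (hu : u ∈ p.1 ∩ p.2)
    (hu' : ¬∃ b ∈ p.2 \ p.1, G.Adj u b) : X ⊆ p.2 \ {u} := by
  refine (hX.2.1 _ (hp.erase_snd hu.1 hu') ((sepOrder_erase_snd hu).trans hpk)).resolve_left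
    fun h => hX.not_subset_inter hpk h hXp

theorem exists_argmin {α : Type*} (P : α → Prop) (f : α → ℕ) {a : α} (ha : P a) :
    ∃ b, P b ∧ f b ≤ f a ∧ ∀ c, P c → f b ≤ f c := by
  obtain ⟨b, hb, hmin⟩ := (measure f).wf.has_min {a | P a} ⟨a, ha⟩
  exact ⟨b, hb, not_lt.1 (hmin a ha), fun c hc => not_lt.1 (hmin c hc)⟩

/-- Every vertex outside a block can be separated from it. -/
theorem IsBlock.exists_sep {X : Set V} (hX : IsBlock G k X) {v : V} (hv : v ∉ X) :
    ∃ p, IsSep G p ∧ sepOrder p < k ∧ X ⊆ p.2 ∧ v ∉ p.2 := by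
  have h : ¬Inseparable' G k (insert v X) := fun h =>
    hv (hX.2.2 _ h (subset_insert _ _) ▸ mem_insert v X)
  simp only [Inseparable', not_forall, not_or, insert_subset_iff] at h
  obtain ⟨p, hp, hpk, h1, h2⟩ := h
  rcases hX.2.1 p hp hpk with hXp | hXp
  · exact ⟨p.swap, hp.swap, by rwa [sepOrder_swap], hXp, fun h => h1 ⟨h, hXp⟩⟩
  · exact ⟨p, hp, hpk, hXp, fun h => h2 ⟨h, hXp⟩⟩

/-- If a block is well separated, then every vertex outside it is separated from it by a tight
separation nested with all tight separations. -/
theorem WellSepIn.exists_tight [Finite V] {X : Set V} {S : Set (Set V × Set V)}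
    (hT : tightSeps G k ⊆ S) (hX : IsBlock G k X) (hw : WellSepIn G k X S)
    {v : V} (hv : v ∉ X) :
    ∃ p ∈ tightSeps G k, X ⊆ p.2 ∧ v ∉ p.2 ∧ ∀ r ∈ tightSeps G k, Nested r p := by
  obtain ⟨p₀, hp₀, hk₀, hX₀, hv₀⟩ := hX.exists_sep hv
  obtain ⟨B, ⟨hXB, hB, hBp⟩, -, hmin⟩ := exists_argmin
    (fun B : Set V => X ⊆ B ∧ sepOrder (trim G B) < k ∧ B ⊆ p₀.2) ncard
    ⟨hX₀, (sepOrder_trim_le hp₀).trans_lt hk₀, subset_rfl⟩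
  replace hmin : ∀ q, IsSep G q → sepOrder q < k → X ⊆ q.2 → q.2 ⊆ B → q.2 = B :=
    fun q hq hqk hXq hqB => Set.eq_of_subset_of_ncard_le hqB
      (hmin _ ⟨hXq, (sepOrder_trim_le hq).trans_lt hqk, hqB.trans hBp⟩) (toFinite _)
  have hvB : v ∉ B := fun h => hv₀ (hBp h)
  have htight : trim G B ∈ tightSeps G k := by
    refine ⟨⟨trim_isSep B, ⟨⟨v, ⟨v, hvB, .inl rfl⟩, hvB⟩, ?_⟩, hB⟩, fun u hu => ⟨?_, ?_⟩⟩
    · rw [nonempty_iff_ne_empty, Ne, sdiff_eq_empty]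
      exact fun h => hX.not_subset_inter hB (hXB.trans h) hXB
    · obtain ⟨⟨a, ha, hua⟩, huB⟩ := hu
      have hua' : G.Adj u a := hua.resolve_left fun h => ha (h ▸ huB)
      exact ⟨a, ⟨⟨a, ha, .inl rfl⟩, ha⟩, hua'⟩
    · by_contra hu'
      have h := hmin _ ((trim_isSep B).erase_snd hu.1 hu') ((sepOrder_erase_snd hu).trans hB)
        (hX.subset_erase_snd (trim_isSep B) hB hXB hu hu') sdiff_subset
      exact (h.symm.subset hu.2).2 rfl
  have hmax : ∀ r ∈ tightSeps G k, X ⊆ r.2 → ∃ q, MaxIn (blockProfile G k X ∩ S) q ∧ SepLE r q := by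
    intro r hr hXr
    obtain ⟨q, hq, hrq, hq'⟩ := exists_maximal_above (· ∈ blockProfile G k X ∩ S) (p := r)
      ⟨⟨hr.1, hXr, fun h => hX.not_subset_inter hr.1.2.2 h hXr⟩, hT hr⟩
    exact ⟨q, ⟨hq, hq'⟩, hrq⟩
  refine ⟨trim G B, htight, hXB, hvB, ?_⟩
  obtain ⟨q, hq, hBq⟩ := hmax _ htight hXB
  have hqB : q.2 = B := hmin q hq.1.1.1.1 hq.1.1.1.2.2 hq.1.1.2.1 hBq.2
  have key : ∀ r ∈ tightSeps G k, X ⊆ r.2 → Nested r (trim G B) := by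
    intro r hr hXr
    obtain ⟨s, hs, hrs⟩ := hmax r hr hXr
    have heq : q = s → Nested r (trim G B) := by
      rintro rfl
      have hBr : B ⊆ r.2 := hqB ▸ hrs.2
      refine .inl ⟨?_, hBr⟩
      rw [hr.2.eq_trim hr.1.1]
      exact trim_anti hBr
    rcases hw q s hq hs with h | h | h | h
    · exact heq (hq.2 s hs.1 h).symm
    · exact heq (hs.2 q hq.1 h)
    · refine .inr (.inr (.inl ⟨?_, ?_⟩))
      · exact hrs.1.trans (h.2.trans hqB.subset)
      · exact hBq.1.trans (h.1.trans hrs.2)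
    · exact (hX.not_subset_inter hq.1.1.1.2.2 (hs.1.1.2.1.trans h.1) hq.1.1.2.1).elim
  intro r hr
  rcases hX.2.1 r hr.1.1 hr.1.2.2 with h | h
  · exact nested_swap_left.1 (key _ (swap_mem_tightSeps hr) h)
  · exact key r hr h

/-! ### Efficient separations crossing few tight separations -/

/-- `p` separates `X` from `Y` and has minimum order with this property. -/
def Efficient (G : SimpleGraph V) (X Y : Set V) (p : Set V × Set V) : Prop :=
  (IsSep G p ∧ X ⊆ p.1 ∧ Y ⊆ p.2) ∧
    ∀ q, IsSep G q → X ⊆ q.1 → Y ⊆ q.2 → sepOrder p ≤ sepOrder q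

theorem Efficient.swap {X Y : Set V} {p : Set V × Set V} (h : Efficient G X Y p) :
    Efficient G Y X p.swap := by
  refine ⟨⟨h.1.1.swap, h.1.2.2, h.1.2.1⟩, fun q hq hY hX => ?_⟩
  rw [sepOrder_swap, ← sepOrder_swap q]
  exact h.2 _ hq.swap hX hY

theorem Efficient.act {X Y : Set V} {p : Set V × Set V} (h : Efficient G X Y p) (φ : G ≃g G) :
    Efficient G (φ '' X) (φ '' Y) (act φ p) := by
  refine ⟨⟨h.1.1.act φ, image_mono h.1.2.1, image_mono h.1.2.2⟩, fun q hq hX hY => ?_⟩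
  rw [sepOrder_act, ← sepOrder_act φ.symm q]
  refine h.2 _ (hq.act _) (fun x hx => ?_) fun y hy => ?_
  · exact ⟨φ x, hX (mem_image_of_mem _ hx), by simp⟩
  · exact ⟨φ y, hY (mem_image_of_mem _ hy), by simp⟩

theorem IsBlock.exists_efficient {X Y : Set V} (hX : IsBlock G k X) (hY : IsBlock G k Y)
    (h : X ≠ Y) : ∃ p, Efficient G X Y p ∧ sepOrder p < k := by
  have : ∃ v ∈ X, v ∉ Y := by
    by_contra! h'
    exact h (hX.2.2 Y hY.2.1 h').symm
  obtain ⟨v, hvX, hvY⟩ := this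
  obtain ⟨p, hp, hpk, hYp, hvp⟩ := hY.exists_sep hvY
  have hXp := (hX.2.1 p hp hpk).resolve_right fun h => hvp (h hvX)
  obtain ⟨q, hq, hqp, hmin⟩ := exists_argmin
    (fun q => IsSep G q ∧ X ⊆ q.1 ∧ Y ⊆ q.2) sepOrder ⟨hp, hXp, hYp⟩
  exact ⟨q, ⟨hq, fun r hr h1 h2 => hmin r ⟨hr, h1, h2⟩⟩, hqp.trans_lt hpk⟩

theorem Efficient.mem_tightSeps [Finite V] {X Y : Set V} {p : Set V × Set V}
    (h : Efficient G X Y p) (hX : IsBlock G k X) (hY : IsBlock G k Y) (hXY : X ≠ Y) :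
    p ∈ tightSeps G k := by
  obtain ⟨q, hq, hqk⟩ := hX.exists_efficient hY hXY
  have hpk := (h.2 q hq.1.1 hq.1.2.1 hq.1.2.2).trans_lt hqk
  have key : ∀ {X Y : Set V} {p : Set V × Set V}, Efficient G X Y p → IsBlock G k Y →
      sepOrder p < k → (p.2 \ p.1).Nonempty ∧
        ∀ u ∈ p.1 ∩ p.2, ∃ b ∈ p.2 \ p.1, G.Adj u b := by
    intro X Y p h hY hpk
    constructor
    · rw [nonempty_iff_ne_empty, Ne, sdiff_eq_empty]
      exact fun h' => hY.not_subset_inter hpk (h.1.2.2.trans h') h.1.2.2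
    · intro u hu
      by_contra hu'
      exact (h.2 _ (h.1.1.erase_snd hu.1 hu') h.1.2.1
        (hY.subset_erase_snd h.1.1 hpk h.1.2.2 hu hu')).not_gt (sepOrder_erase_snd hu)
  have h1 := key h hY hpk
  have h2 := key h.swap hX (by rwa [sepOrder_swap])
  exact ⟨⟨h.1.1, ⟨h2.1, h1.1⟩, hpk⟩, fun u hu => ⟨h2.2 u ⟨hu.2, hu.1⟩, h1.2 u hu⟩⟩

/-- The number of tight separations that `p` crosses. -/
noncomputable def crossing (G : SimpleGraph V) (k : ℕ) (p : Set V × Set V) : ℕ :=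
  {r | r ∈ tightSeps G k ∧ ¬Nested r p}.ncard

theorem crossing_swap (p : Set V × Set V) : crossing G k p.swap = crossing G k p := by
  simp only [crossing, nested_swap_right]

theorem crossing_act [Finite V] (φ : G ≃g G) (p : Set V × Set V) :
    crossing G k (act φ p) = crossing G k p := by
  have key : ∀ (φ : G ≃g G) (p : Set V × Set V), crossing G k (act φ p) ≤ crossing G k p := by
    intro φ p
    refine ncard_le_ncard_of_injOn (act φ.symm) ?_ ?_ (toFinite _)
    · rintro r ⟨hr, hrp⟩
      refine ⟨act_mem_tightSeps hr _, fun h => hrp ?_⟩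
      have := h.act φ
      rwa [act_act_symm] at this
    · intro r _ s _ hrs
      rw [← act_act_symm φ r, hrs, act_act_symm]
  refine (key φ p).antisymm ?_
  conv_lhs => rw [← act_symm_act φ p]
  exact key _ _

theorem Nested.inf {p q r : Set V × Set V} (hp : Nested r p) (hq : Nested r q)
    (hpq : ¬Nested p q) : Nested r (p.1 ∩ q.1, p.2 ∪ q.2) := by
  have hlp : SepLE (p.1 ∩ q.1, p.2 ∪ q.2) p := ⟨inter_subset_left, subset_union_left⟩
  have hlq : SepLE (p.1 ∩ q.1, p.2 ∪ q.2) q := ⟨inter_subset_right, subset_union_right⟩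
  rcases hp with hp | hp | hp | hp
  · rcases hq with hq | hq | hq | hq
    · exact .inl ⟨subset_inter hp.1 hq.1, union_subset hp.2 hq.2⟩
    · exact .inr (.inl (hlq.trans hq))
    · exact .inr (.inr (.inl (hq.trans ⟨hlq.2, hlq.1⟩)))
    · exact absurd (.inr (.inr (.inr (hq.trans hp)))) hpq
  · exact .inr (.inl (hlp.trans hp))
  · exact .inr (.inr (.inl (hp.trans ⟨hlp.2, hlp.1⟩)))
  · rcases hq with hq | hq | hq | hq
    · have h := hp.trans hq
      exact absurd (.inr (.inr (.inr ⟨h.2, h.1⟩))) hpq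
    · exact .inr (.inl (hlq.trans hq))
    · exact .inr (.inr (.inl (hq.trans ⟨hlq.2, hlq.1⟩)))
    · exact .inr (.inr (.inr ⟨union_subset hp.1 hq.1, subset_inter hp.2 hq.2⟩))

theorem Nested.sup {p q r : Set V × Set V} (hp : Nested r p) (hq : Nested r q)
    (hpq : ¬Nested p q) : Nested r (p.1 ∪ q.1, p.2 ∩ q.2) :=
  nested_swap_right.1 (hp.swap_right.inf hq.swap_right
    (by rwa [nested_swap_left, nested_swap_right]))

theorem Nested.inf_or_sup {p r : Set V × Set V} (h : Nested r p) (q : Set V × Set V) :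
    Nested r (p.1 ∩ q.1, p.2 ∪ q.2) ∨ Nested r (p.1 ∪ q.1, p.2 ∩ q.2) := by
  have hlp : SepLE (p.1 ∩ q.1, p.2 ∪ q.2) p := ⟨inter_subset_left, subset_union_left⟩
  have hpl : SepLE p (p.1 ∪ q.1, p.2 ∩ q.2) := ⟨subset_union_left, inter_subset_left⟩
  rcases h with h | h | h | h
  · exact .inr (.inl (h.trans hpl))
  · exact .inl (.inr (.inl (hlp.trans h)))
  · exact .inl (.inr (.inr (.inl (h.trans ⟨hlp.2, hlp.1⟩))))
  · exact .inr (.inr (.inr (.inr (SepLE.trans (q := p.swap) ⟨hpl.2, hpl.1⟩ h))))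

theorem crossing_inf_add_sup_lt [Finite V] {p q : Set V × Set V} (hp : p ∈ tightSeps G k)
    (hpq : ¬Nested p q) :
    crossing G k (p.1 ∩ q.1, p.2 ∪ q.2) + crossing G k (p.1 ∪ q.1, p.2 ∩ q.2) <
      crossing G k p + crossing G k q := by
  unfold crossing
  rw [← ncard_union_add_ncard_inter _ _ (toFinite _) (toFinite _),
    ← ncard_union_add_ncard_inter {r | r ∈ tightSeps G k ∧ ¬Nested r p} _ (toFinite _)
      (toFinite _)]
  refine add_lt_add_of_lt_of_le (ncard_lt_ncard ⟨?_, fun h => ?_⟩ (toFinite _))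
    (ncard_le_ncard ?_ (toFinite _))
  · rintro r (⟨hr, h⟩ | ⟨hr, h⟩)
    · by_contra h'
      simp only [mem_union, mem_ofPred_eq, hr, true_and, not_or, not_not] at h'
      exact h (h'.1.inf h'.2 hpq)
    · by_contra h'
      simp only [mem_union, mem_ofPred_eq, hr, true_and, not_or, not_not] at h'
      exact h (h'.1.sup h'.2 hpq)
  · rcases h (.inr ⟨hp, hpq⟩) with h' | h'
    · exact h'.2 (.inr (.inl ⟨inter_subset_left, subset_union_left⟩))
    · exact h'.2 (.inl ⟨subset_union_left, inter_subset_left⟩)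
  · rintro r ⟨⟨hr, h1⟩, -, h2⟩
    refine ⟨⟨hr, fun h => ?_⟩, hr, fun h => ?_⟩
    · exact (h.inf_or_sup q).elim h1 h2
    · have := h.inf_or_sup p
      rw [inter_comm, union_comm, union_comm q.1, inter_comm q.2] at this
      exact this.elim h1 h2

theorem IsSep.inf {p q : Set V × Set V} (hp : IsSep G p) (hq : IsSep G q) :
    IsSep G (p.1 ∩ q.1, p.2 ∪ q.2) := by
  refine ⟨eq_univ_of_forall fun v => ?_, ?_⟩
  · have h1 : v ∈ p.1 ∪ p.2 := hp.1 ▸ mem_univ v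
    have h2 : v ∈ q.1 ∪ q.2 := hq.1 ▸ mem_univ v
    simp only [mem_union, mem_inter_iff] at h1 h2 ⊢
    tauto
  · rintro a ⟨ha, ha'⟩ b ⟨hb, hb'⟩ hab
    simp only [mem_union, mem_inter_iff] at ha ha' hb hb'
    have h1 : b ∈ p.1 ∪ p.2 := hp.1 ▸ mem_univ b
    have h2 : b ∈ q.1 ∪ q.2 := hq.1 ▸ mem_univ b
    have h3 := hp.2 a
    have h4 := hq.2 a
    simp only [mem_sdiff, mem_union] at h1 h2 h3 h4
    by_cases hbp : b ∈ p.1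
    · exact h4 ⟨ha.2, by tauto⟩ b ⟨by tauto, by tauto⟩ hab
    · exact h3 ⟨ha.1, by tauto⟩ b ⟨by tauto, by tauto⟩ hab

theorem IsSep.sup {p q : Set V × Set V} (hp : IsSep G p) (hq : IsSep G q) :
    IsSep G (p.1 ∪ q.1, p.2 ∩ q.2) := (hp.swap.inf hq.swap).swap

theorem sepOrder_inf_add_sup_le [Finite V] (p q : Set V × Set V) :
    sepOrder (p.1 ∩ q.1, p.2 ∪ q.2) + sepOrder (p.1 ∪ q.1, p.2 ∩ q.2) ≤
      sepOrder p + sepOrder q := by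
  unfold sepOrder
  rw [← ncard_union_add_ncard_inter _ _ (toFinite _) (toFinite _),
    ← ncard_union_add_ncard_inter (p.1 ∩ p.2) _ (toFinite _) (toFinite _)]
  refine add_le_add (ncard_le_ncard (fun v hv => ?_) (toFinite _))
    (ncard_le_ncard (fun v hv => ?_) (toFinite _)) <;>
  · simp only [mem_union, mem_inter_iff] at hv ⊢
    tauto

/-- `p` is an efficient separation of `X` and `Y` that crosses as few tight separations as
possible. -/
def Optimal (G : SimpleGraph V) (k : ℕ) (X Y : Set V) (p : Set V × Set V) : Prop :=
  Efficient G X Y p ∧ ∀ q, Efficient G X Y q → crossing G k p ≤ crossing G k q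

theorem Optimal.swap {X Y : Set V} {p : Set V × Set V} (h : Optimal G k X Y p) :
    Optimal G k Y X p.swap := by
  refine ⟨h.1.swap, fun q hq => ?_⟩
  rw [crossing_swap, ← crossing_swap q]
  exact h.2 _ hq.swap

theorem Optimal.act [Finite V] {X Y : Set V} {p : Set V × Set V} (h : Optimal G k X Y p)
    (φ : G ≃g G) : Optimal G k (φ '' X) (φ '' Y) (act φ p) := by
  refine ⟨h.1.act φ, fun q hq => ?_⟩
  rw [crossing_act, ← crossing_act φ.symm q]
  refine h.2 _ ?_
  simpa [image_image] using hq.act φ.symm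

theorem IsBlock.exists_optimal {X Y : Set V} (hX : IsBlock G k X) (hY : IsBlock G k Y)
    (h : X ≠ Y) : ∃ p, Optimal G k X Y p := by
  obtain ⟨p, hp, -⟩ := hX.exists_efficient hY h
  obtain ⟨q, hq, -, hmin⟩ := exists_argmin (Efficient G X Y) (crossing G k) hp
  exact ⟨q, hq, hmin⟩

theorem Optimal.nested_of_subset [Finite V] {X Y Z W : Set V} {p q : Set V × Set V}
    (hp : Optimal G k X Y p) (hq : Optimal G k Z W q) (hpT : p ∈ tightSeps G k)
    (hX : X ⊆ q.1) (hW : W ⊆ p.2) : Nested p q := by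
  by_contra hpq
  have h1 : IsSep G (p.1 ∩ q.1, p.2 ∪ q.2) := hp.1.1.1.inf hq.1.1.1
  have h2 : IsSep G (p.1 ∪ q.1, p.2 ∩ q.2) := hp.1.1.1.sup hq.1.1.1
  have hXi : X ⊆ p.1 ∩ q.1 := subset_inter hp.1.1.2.1 hX
  have hYi : Y ⊆ p.2 ∪ q.2 := hp.1.1.2.2.trans subset_union_left
  have hZs : Z ⊆ p.1 ∪ q.1 := hq.1.1.2.1.trans subset_union_right
  have hWs : W ⊆ p.2 ∩ q.2 := subset_inter hW hq.1.1.2.2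
  have o1 := hp.1.2 _ h1 hXi hYi
  have o2 := hq.1.2 _ h2 hZs hWs
  have o := sepOrder_inf_add_sup_le p q
  have c1 := hp.2 _ ⟨⟨h1, hXi, hYi⟩, fun r hr hrX hrY =>
    le_trans (by omega) (hp.1.2 r hr hrX hrY)⟩
  have c2 := hq.2 _ ⟨⟨h2, hZs, hWs⟩, fun r hr hrZ hrW =>
    le_trans (by omega) (hq.1.2 r hr hrZ hrW)⟩
  have c := crossing_inf_add_sup_lt hpT hpq
  omega

theorem Optimal.nested_of_separates [Finite V] {X Y Z W : Set V} {p q : Set V × Set V}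
    (hp : Optimal G k X Y p) (hq : Optimal G k Z W q) (hpT : p ∈ tightSeps G k)
    (hX : X ⊆ q.1) (hY : Y ⊆ q.2) (hZ : Z ⊆ p.2) (hW : W ⊆ p.1) : Nested p q := by
  by_contra hpq
  have h1 : IsSep G (p.1 ∩ q.1, p.2 ∪ q.2) := hp.1.1.1.inf hq.1.1.1
  have h2 : IsSep G (p.1 ∪ q.1, p.2 ∩ q.2) := hp.1.1.1.sup hq.1.1.1
  have hXi : X ⊆ p.1 ∩ q.1 := subset_inter hp.1.1.2.1 hX
  have hYi : Y ⊆ p.2 ∪ q.2 := hp.1.1.2.2.trans subset_union_left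
  have hXs : X ⊆ p.1 ∪ q.1 := hX.trans subset_union_right
  have hYs : Y ⊆ p.2 ∩ q.2 := subset_inter hp.1.1.2.2 hY
  have o1 := hp.1.2 _ h1 hXi hYi
  have o2 := hp.1.2 _ h2 hXs hYs
  have o3 := hp.1.2 _ hq.1.1.1 hX hY
  have o4 := hq.1.2 _ hp.1.1.1.swap hZ hW
  rw [sepOrder_swap] at o4
  have o := sepOrder_inf_add_sup_le p q
  have c1 := hp.2 _ ⟨⟨h1, hXi, hYi⟩, fun r hr hrX hrY =>
    le_trans (by omega) (hp.1.2 r hr hrX hrY)⟩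
  have c2 := hp.2 _ ⟨⟨h2, hXs, hYs⟩, fun r hr hrX hrY =>
    le_trans (by omega) (hp.1.2 r hr hrX hrY)⟩
  have c3 := hq.2 p.swap ⟨⟨hp.1.1.1.swap, hZ, hW⟩, fun r hr hrZ hrW => by
    rw [sepOrder_swap]
    exact le_trans (by omega) (hq.1.2 r hr hrZ hrW)⟩
  rw [crossing_swap] at c3
  have c := crossing_inf_add_sup_lt hpT hpq
  omega

theorem Optimal.nested [Finite V] {X Y Z W : Set V} {p q : Set V × Set V}
    (hX : IsBlock G k X) (hY : IsBlock G k Y) (hZ : IsBlock G k Z) (hW : IsBlock G k W)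
    (hp : Optimal G k X Y p) (hq : Optimal G k Z W q) (hpT : p ∈ tightSeps G k)
    (hqT : q ∈ tightSeps G k) : Nested p q := by
  have hpT' := swap_mem_tightSeps hpT
  have n1 := hp.nested_of_subset hq hpT
  have n2 := hp.nested_of_subset hq.swap hpT
  have n3 := hp.swap.nested_of_subset hq hpT'
  have n4 := hp.swap.nested_of_subset hq.swap hpT'
  have n5 := hp.nested_of_separates hq hpT
  have n6 := hp.nested_of_separates hq.swap hpT
  simp only [nested_swap_left, nested_swap_right, Prod.fst_swap, Prod.snd_swap] at *
  rcases hX.2.1 q hqT.1.1 hqT.1.2.2 with hX | hX <;>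
  rcases hY.2.1 q hqT.1.1 hqT.1.2.2 with hY | hY <;>
  rcases hZ.2.1 p hpT.1.1 hpT.1.2.2 with hZ | hZ <;>
  rcases hW.2.1 p hpT.1.1 hpT.1.2.2 with hW | hW <;>
  first
  | exact n1 hX hW
  | exact n2 hX hZ
  | exact n3 hY hW
  | exact n4 hY hZ
  | exact n5 hX hY hZ hW
  | exact n6 hX hY hW hZ

/-- The separations from which the tree-decomposition is built. -/
def treeSeps (G : SimpleGraph V) (k : ℕ) : Set (Set V × Set V) :=
  {p | p ∈ tightSeps G k ∧ ((∀ r ∈ tightSeps G k, Nested r p) ∨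
    ∃ X Y, IsBlock G k X ∧ IsBlock G k Y ∧ Optimal G k X Y p)}

theorem treeSeps_isTreeSystem [Finite V] : IsTreeSystem G (treeSeps G k) where
  sep p hp := hp.1.1.1
  proper p hp := hp.1.1.2.1
  swap p hp := by
    refine ⟨swap_mem_tightSeps hp.1, hp.2.imp (fun h r hr => (h r hr).swap_right) ?_⟩
    rintro ⟨X, Y, hX, hY, h⟩
    exact ⟨Y, X, hY, hX, h.swap⟩
  nested p hp q hq := by
    rcases hq.2 with h | ⟨Z, W, hZ, hW, hq'⟩
    · exact h p hp.1
    rcases hp.2 with h | ⟨X, Y, hX, hY, hp'⟩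
    · exact (h q hq.1).symm
    exact Optimal.nested hX hY hZ hW hp' hq' hp.1 hq.1

theorem act_mem_treeSeps [Finite V] (φ : G ≃g G) (p : Set V × Set V) (hp : p ∈ treeSeps G k) :
    act φ p ∈ treeSeps G k := by
  refine ⟨act_mem_tightSeps hp.1 φ, hp.2.imp (fun h r hr => ?_) ?_⟩
  · have := (h _ (act_mem_tightSeps hr φ.symm)).act φ
    rwa [act_act_symm] at this
  · rintro ⟨X, Y, hX, hY, h⟩
    exact ⟨_, _, hX.act φ, hY.act φ, h.act φ⟩

end Blocks

/-- Theorem 3.1: `G` has a canonical tree-decomposition with induced separations in `S`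
such that distinct `k`-blocks lie in different parts, every `k`-block lies in some part,
and every part containing a well-separated `k`-block coincides with that block. -/
theorem stmt_7 {V : Type*} [Fintype V] (G : SimpleGraph V) (k : ℕ) (hk : 1 ≤ k)
    (S : Set (Set V × Set V))
    (hS : ∀ p ∈ S, IsSep G p ∧ ProperSep p ∧ sepOrder p < k)
    (htight : ∀ p : Set V × Set V,
      IsSep G p → ProperSep p → TightSep G p → sepOrder p < k → p ∈ S)
    (hinv : ∀ (φ : G ≃g G), ∀ p ∈ S, ((⇑φ) '' p.1, (⇑φ) '' p.2) ∈ S) :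
    ∃ (ι : Type) (_ : Fintype ι) (T : SimpleGraph ι) (Vt : ι → Set V),
      IsTreeDecomp G T Vt ∧ Canonical G T Vt ∧
      inducedSeps T Vt ⊆ S ∧
      (∀ (t : ι) (X X' : Set V), IsBlock G k X → IsBlock G k X' → X ≠ X' →
        X ⊆ Vt t → ¬X' ⊆ Vt t) ∧
      (∀ X : Set V, IsBlock G k X → ∃ t : ι, X ⊆ Vt t) ∧
      (∀ (t : ι) (X : Set V), IsBlock G k X → WellSepIn G k X S →
        X ⊆ Vt t → Vt t = X) := by
  classical
  have hT : tightSeps G k ⊆ S := fun p hp => htight p hp.1.1 hp.1.2.1 hp.2 hp.1.2.2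
  have hN : IsTreeSystem G (treeSeps G k) := treeSeps_isTreeSystem
  let e := (Finite.equivFin {O // IsNode (treeSeps G k) O}).symm
  refine ⟨_, inferInstance, nodeTree e, fun l => part (e l).1, nodeTree_isTreeDecomp e hN,
    nodeTree_canonical e act_mem_treeSeps, ?_, ?_, ?_, ?_⟩
  · rintro p ⟨i, j, hij, rfl⟩
    obtain ⟨p, hi, hj, -⟩ := id hij
    rw [nodeTree_inducedSep e hN hij hi hj]
    exact hT (swap_mem_tightSeps ((e i).2.subset hi).1)
  · intro t X X' hX hX' hne hXt hXt'
    obtain ⟨p, hp⟩ := hX.exists_optimal hX' hne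
    have hpT := hp.1.mem_tightSeps hX hX' hne
    have hpN : p ∈ treeSeps G k := ⟨hpT, .inr ⟨X, X', hX, hX', hp⟩⟩
    by_cases hpt : p ∈ (e t).1
    · exact hX.not_subset_inter hpT.1.2.2 hp.1.1.2.1 fun v hv => hXt hv p hpt
    · exact hX'.not_subset_inter hpT.1.2.2
        (fun v hv => hXt' hv _ ((e t).2.swap_mem hpN hpt)) hp.1.1.2.2
  · intro X hX
    obtain ⟨O, hO⟩ := hN.exists_node
    obtain ⟨O', hO', -, h⟩ := hN.exists_subset_part (R := ∅)
      (fun p hp => hX.2.1 p hp.1.1.1 hp.1.1.2.2) (by simp) hO (empty_subset _)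
    exact ⟨e.symm ⟨O', hO'⟩, by simpa using h⟩
  · intro t X hX hw hXt
    refine Subset.antisymm (fun v hv => ?_) hXt
    by_contra hvX
    obtain ⟨p, hpT, hXp, hvp, hp⟩ := hw.exists_tight hT hX hvX
    have hpt : p ∈ (e t).1 := by
      by_contra hpt
      exact hX.not_subset_inter hpT.1.2.2
        (fun x hx => hXt hx _ ((e t).2.swap_mem ⟨hpT, .inl hp⟩ hpt)) hXp
    exact hvp (hv p hpt)

end CanonicalTD
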